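/- Let A ∈ L¹(ℝ³; ℂ³) ∩ L^∞(ℝ³; ℂ³) be supported in B'_{R₁} × ℝ (cylinder coordinates adapted to an orthonormal frame (θ̃, η, ξ/|ξ|) of ℝ³ with ξ ≠ 0, ξ·θ̃ = ξ·η = 0). Write x = (x''₁, x''₂, x_*) in coordinates x''₁ = x·θ̃, x''₂ = x·η, x_* = x·ξ/|ξ|, and define Φ(x) := (-i/2π) ∫_{ℝ²} [(θ̃+iη)·A(x - s₁θ̃ - s₂η)]/(s₁ + i s₂) ds₁ ds₂. Then ∫_{ℝ³} (A(x)·(θ̃+iη)) e^{Φ(x)} e^{-i x·ξ} dx = (θ̃+iη) · ∫_{ℝ³} A(x) e^{-i x·ξ} dx. -/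

import Mathlib

open MeasureTheory Complex
open scoped RealInnerProductSpace

noncomputable section

local notation "E3" => EuclideanSpace ℝ (Fin 3)

lemma ct_c0 : ∫⁻ u in Metric.ball (0:ℂ) 1, ‖u⁻¹‖ₑ < ⊤ := by
  rw [← lintegral_indicator measurableSet_ball, ← Complex.lintegral_comp_polarCoord_symm]
  have h : ∀ p ∈ polarCoord.target, ENNReal.ofReal p.1 • (Metric.ball (0:ℂ) 1).indicator (fun u => ‖u⁻¹‖ₑ) (Complex.polarCoord.symm p) ≤ (Set.Ioo (0:ℝ) 1 ×ˢ Set.Ioo (-Real.pi) Real.pi).indicator (fun _ => (1:ENNReal)) p := by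
    intro p hp
    rw [polarCoord_target] at hp
    have hp1 : 0 < p.1 := hp.1
    by_cases h1 : p.1 < 1
    · rw [Set.indicator_of_mem (s := (Set.Ioo (0:ℝ) 1 ×ˢ Set.Ioo (-Real.pi) Real.pi)) ⟨⟨hp1, h1⟩, hp.2⟩]
      rw [Set.indicator_of_mem (by simp [abs_of_pos hp1, h1])]
      rw [← ofReal_norm, norm_inv, Complex.norm_polarCoord_symm, abs_of_pos hp1, smul_eq_mul, ← ENNReal.ofReal_mul hp1.le, mul_inv_cancel₀ hp1.ne']
      simp
    · rw [Set.indicator_of_notMem (by simp [abs_of_pos hp1] at *; exact h1)]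
      simp
  refine lt_of_le_of_lt (setLIntegral_mono' polarCoord.open_target.measurableSet h) ?_
  refine lt_of_le_of_lt (setLIntegral_le_lintegral _ _) ?_
  rw [lintegral_indicator (measurableSet_Ioo.prod measurableSet_Ioo)]
  simp [Measure.volume_eq_prod, Measure.prod_prod]

lemma ct_kbound (f : ℂ → ℂ) (M : ENNReal) (hM : ∀ w, ‖f w‖ₑ ≤ M) (z : ℂ) :
    ∫⁻ w, ‖f w * (z - w)⁻¹‖ₑ ≤ M * (∫⁻ u in Metric.ball (0:ℂ) 1, ‖u⁻¹‖ₑ) + ∫⁻ w, ‖f w‖ₑ := by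
  have hm : Measurable ((Metric.ball (0:ℂ) 1).indicator (fun u : ℂ => ‖u⁻¹‖ₑ)) :=
    Measurable.indicator (by fun_prop) measurableSet_ball
  calc ∫⁻ w, ‖f w * (z - w)⁻¹‖ₑ 
      ≤ ∫⁻ w, (M * (Metric.ball (0:ℂ) 1).indicator (fun u => ‖u⁻¹‖ₑ) (z - w) + ‖f w‖ₑ) := by
        refine lintegral_mono fun w => ?_
        simp only [enorm_mul]
        by_cases h : z - w ∈ Metric.ball (0:ℂ) 1
        · rw [Set.indicator_of_mem h]
          exact le_add_right (mul_le_mul_left (hM w) _)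
        · rw [Set.indicator_of_notMem h]
          have h' : 1 ≤ ‖z - w‖ := by simpa using h
          have : ‖(z-w)⁻¹‖ₑ ≤ 1 := by
            rw [← ofReal_norm, norm_inv]
            exact ENNReal.ofReal_le_one.2 (inv_le_one_of_one_le₀ h')
          simpa using mul_le_mul_right this ‖f w‖ₑ
    _ = _ := by
        rw [lintegral_add_left (by fun_prop), lintegral_const_mul _ (by fun_prop),
          lintegral_sub_left_eq_self (fun u => (Metric.ball (0:ℂ) 1).indicator (fun u => ‖u⁻¹‖ₑ) u) z,
          lintegral_indicator measurableSet_ball]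

def CT (f : ℂ → ℂ) (z : ℂ) : ℂ := ∫ w, f w * (z - w)⁻¹

structure Nice (f : ℂ → ℂ) : Prop where
  int : Integrable f
  bd : ∃ M : ℝ, ∀ z, ‖f z‖ ≤ M

lemma Nice.kb {f : ℂ → ℂ} (h : Nice f) : ∃ B : ℝ, 0 ≤ B ∧ ∀ z, ∫⁻ w, ‖f w * (z - w)⁻¹‖ₑ ≤ ENNReal.ofReal B := by
  obtain ⟨M, hM⟩ := h.bd
  have hM' : ∀ w, ‖f w‖ₑ ≤ ENNReal.ofReal M := fun w => by
    rw [← ofReal_norm]; exact ENNReal.ofReal_le_ofReal (hM w)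
  refine ⟨(ENNReal.ofReal M * (∫⁻ u in Metric.ball (0:ℂ) 1, ‖u⁻¹‖ₑ) + ∫⁻ w, ‖f w‖ₑ).toReal, ENNReal.toReal_nonneg, fun z => (ct_kbound f _ hM' z).trans ?_⟩
  rw [ENNReal.ofReal_toReal]
  exact ENNReal.add_ne_top.2 ⟨ENNReal.mul_ne_top ENNReal.ofReal_ne_top ct_c0.ne, h.int.2.ne⟩

lemma Nice.aesm_k {f : ℂ → ℂ} (h : Nice f) (z : ℂ) : AEStronglyMeasurable (fun w => f w * (z - w)⁻¹) :=
  h.int.1.mul (by fun_prop : Measurable fun w : ℂ => (z - w)⁻¹).aestronglyMeasurable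

lemma Nice.int_k {f : ℂ → ℂ} (h : Nice f) (z : ℂ) : Integrable (fun w => f w * (z - w)⁻¹) := by
  obtain ⟨B, -, hB⟩ := h.kb
  exact ⟨h.aesm_k z, (hB z).trans_lt ENNReal.ofReal_lt_top⟩

lemma Nice.aesm_prod {f : ℂ → ℂ} (h : Nice f) : AEStronglyMeasurable (fun p : ℂ × ℂ => f p.2 * (p.1 - p.2)⁻¹) (volume.prod volume) :=
  h.int.1.comp_snd.mul (by fun_prop : Measurable fun p : ℂ × ℂ => (p.1 - p.2)⁻¹).aestronglyMeasurable

lemma Nice.aesm_CT {f : ℂ → ℂ} (h : Nice f) : AEStronglyMeasurable (CT f) :=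
  h.aesm_prod.integral_prod_right'

lemma Nice.bd_CT {f : ℂ → ℂ} (h : Nice f) : ∃ B : ℝ, 0 ≤ B ∧ ∀ z, ‖CT f z‖ ≤ B := by
  obtain ⟨B, h0, hB⟩ := h.kb
  refine ⟨B, h0, fun z => ?_⟩
  have := (enorm_integral_le_lintegral_enorm (fun w => f w * (z - w)⁻¹)).trans (hB z)
  rw [← ofReal_norm] at this
  exact (ENNReal.ofReal_le_ofReal_iff h0).1 this

lemma Nice.mulCT {f g : ℂ → ℂ} (hf : Nice f) (hg : Nice g) : Nice (fun z => f z * CT g z) := by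
  obtain ⟨B, h0, hB⟩ := hg.bd_CT
  obtain ⟨M, hM⟩ := hf.bd
  refine ⟨hf.int.mul_bdd hg.aesm_CT (Filter.Eventually.of_forall hB), M * B, fun z => ?_⟩
  rw [norm_mul]
  exact mul_le_mul (hM z) (hB z) (norm_nonneg _) ((norm_nonneg _).trans (hM z))

lemma Nice.int_prod {φ g : ℂ → ℂ} (hφ : Integrable φ) (hg : Nice g) :
    Integrable (fun p : ℂ × ℂ => φ p.1 * (g p.2 * (p.1 - p.2)⁻¹)) (volume.prod volume) := by
  obtain ⟨B, h0, hB⟩ := hg.kb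
  have hm : AEStronglyMeasurable (fun p : ℂ × ℂ => φ p.1 * (g p.2 * (p.1 - p.2)⁻¹)) (volume.prod volume) :=
    hφ.1.comp_fst.mul hg.aesm_prod
  refine ⟨hm, ?_⟩
  rw [HasFiniteIntegral, lintegral_prod _ hm.enorm]
  calc _ ≤ ∫⁻ x, ‖φ x‖ₑ * ENNReal.ofReal B := by
        refine lintegral_mono fun x => ?_
        simp only [enorm_mul (φ x)]
        rw [lintegral_const_mul'' _ (hg.aesm_k x).enorm]
        exact mul_le_mul_right (hB x) _
    _ < ⊤ := by
        rw [lintegral_mul_const' _ _ ENNReal.ofReal_ne_top]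
        exact ENNReal.mul_lt_top hφ.2 ENNReal.ofReal_lt_top

lemma int_swap {φ g : ℂ → ℂ} (hφ : Integrable φ) (hg : Nice g) :
    ∫ w, φ w * CT g w = ∫ p : ℂ × ℂ, φ p.1 * (g p.2 * (p.1 - p.2)⁻¹) ∂(volume.prod volume) := by
  rw [integral_prod _ (Nice.int_prod hφ hg)]
  simp only [integral_const_mul]
  rfl

lemma int_swap' {φ g : ℂ → ℂ} (hφ : Integrable φ) (hg : Nice g) :
    ∫ w, φ w * CT g w = ∫ p : ℂ × ℂ, φ p.2 * (g p.1 * (p.2 - p.1)⁻¹) ∂(volume.prod volume) := by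
  rw [int_swap hφ hg, ← integral_prod_swap]
  rfl

lemma int_prod' {φ g : ℂ → ℂ} (hφ : Integrable φ) (hg : Nice g) :
    Integrable (fun p : ℂ × ℂ => φ p.2 * (g p.1 * (p.2 - p.1)⁻¹)) (volume.prod volume) := 
  (Nice.int_prod hφ hg).swap

lemma CT_antisymm {f g : ℂ → ℂ} (hf : Nice f) (hg : Nice g) :
    ∫ w, f w * CT g w = - ∫ w, g w * CT f w := by
  rw [int_swap hf.int hg, int_swap' hg.int hf, ← integral_neg]
  congr 1; ext p
  rw [← neg_sub p.1 p.2, inv_neg]; ring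

lemma CT_mul {f g : ℂ → ℂ} (hf : Nice f) (hg : Nice g) (z : ℂ) :
    CT f z * CT g z = CT (fun w => f w * CT g w) z + CT (fun w => g w * CT f w) z := by
  have e1 : CT (fun w => f w * CT g w) z = ∫ w, (f w * (z - w)⁻¹) * CT g w := by
    unfold CT; congr 1; ext w; ring
  have e2 : CT (fun w => g w * CT f w) z = ∫ w, (g w * (z - w)⁻¹) * CT f w := by
    unfold CT; congr 1; ext w; ring
  rw [e1, e2, int_swap (hf.int_k z) hg, int_swap' (hg.int_k z) hf,
    ← integral_add (Nice.int_prod (hf.int_k z) hg) (int_prod' (hg.int_k z) hf)]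
  unfold CT
  rw [← integral_prod_mul]
  refine integral_congr_ae ?_
  have hs : MeasurableSet {p : ℂ × ℂ | p.1 ≠ z ∧ p.2 ≠ z ∧ p.2 ≠ p.1} := by
    refine MeasurableSet.inter ?_ (MeasurableSet.inter ?_ ?_)
    · exact (measurableSet_eq_fun measurable_fst measurable_const).compl
    · exact (measurableSet_eq_fun measurable_snd measurable_const).compl
    · exact (measurableSet_eq_fun measurable_snd measurable_fst).compl
  have : ∀ᵐ p : ℂ × ℂ ∂(volume.prod volume), p.1 ≠ z ∧ p.2 ≠ z ∧ p.2 ≠ p.1 := by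
    rw [Measure.ae_prod_iff_ae_ae hs]
    filter_upwards [Measure.ae_ne volume z] with w hw
    filter_upwards [Measure.ae_ne volume z, Measure.ae_ne volume w] with v hv hv'
    exact ⟨hw, hv, hv'⟩
  filter_upwards [this] with p ⟨h1, h2, h3⟩
  have a1 := sub_ne_zero.2 h1.symm
  have a2 := sub_ne_zero.2 h2.symm
  have a3 := sub_ne_zero.2 h3
  have a4 := sub_ne_zero.2 h3.symm
  have : (p.2 - p.1)⁻¹ = -(p.1-p.2)⁻¹ := by rw [← neg_sub p.1 p.2, inv_neg]
  simp only [this]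
  field_simp
  ring

lemma Nice.pow {f : ℂ → ℂ} (hf : Nice f) (n : ℕ) : Nice (fun z => f z * CT f z ^ n) := by
  obtain ⟨B, h0, hB⟩ := hf.bd_CT
  obtain ⟨M, hM⟩ := hf.bd
  have hB' : ∀ z, ‖CT f z ^ n‖ ≤ B ^ n := fun z => by
    rw [norm_pow]; exact pow_le_pow_left₀ (norm_nonneg _) (hB z) n
  refine ⟨hf.int.mul_bdd (hf.aesm_CT.pow n) (Filter.Eventually.of_forall hB'), M * B ^ n, fun z => ?_⟩
  rw [norm_mul]
  exact mul_le_mul (hM z) (hB' z) (norm_nonneg _) ((norm_nonneg _).trans (hM z))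

lemma CT_const_mul (c : ℂ) (f : ℂ → ℂ) (z : ℂ) : CT (fun w => c * f w) z = c * CT f z := by
  unfold CT
  rw [← integral_const_mul]
  simp only [mul_assoc]

lemma CT_pow {f : ℂ → ℂ} (hf : Nice f) (n : ℕ) (z : ℂ) :
    CT f z ^ (n+1) = (n+1) * CT (fun w => f w * CT f w ^ n) z := by
  induction n generalizing z with
  | zero => simp
  | succ n ih =>
    have h : CT (fun w => f w * CT (fun w => f w * CT f w ^ n) w) z = (n+1 : ℂ)⁻¹ * CT (fun w => f w * CT f w ^ (n+1)) z := by
      rw [← CT_const_mul]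
      congr 1; ext w
      have : (n+1:ℂ) ≠ 0 := by exact_mod_cast n.succ_ne_zero
      rw [ih w]; field_simp
    have h2 : CT (fun w => f w * CT f w ^ n * CT f w) z = CT (fun w => f w * CT f w ^ (n+1)) z := by
      congr 1; ext w; ring
    have : (n+1:ℂ) ≠ 0 := by exact_mod_cast n.succ_ne_zero
    rw [pow_succ', ih z, mul_left_comm, CT_mul hf (hf.pow n), h, h2]
    push_cast
    field_simp
    ring

lemma CT_pow_int {f : ℂ → ℂ} (hf : Nice f) (n : ℕ) : ∫ z, f z * CT f z ^ (n+1) = 0 := by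
  have h1 : ∫ z, f z * CT f z ^ (n+1) = (n+1) * ∫ z, f z * CT (fun w => f w * CT f w ^ n) z := by
    rw [← integral_const_mul]; congr 1; ext z; rw [CT_pow hf]; ring
  rw [CT_antisymm hf (hf.pow n)] at h1
  have h2 : ∫ w, f w * CT f w ^ n * CT f w = ∫ z, f z * CT f z ^ (n+1) := by
    congr 1; ext w; ring
  rw [h2] at h1
  have : (n+2:ℂ) ≠ 0 := by exact_mod_cast (n+1).succ_ne_zero
  have h3 : (n+2:ℂ) * ∫ z, f z * CT f z ^ (n+1) = 0 := by linear_combination h1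
  exact (mul_eq_zero.1 h3).resolve_left this

lemma CT_exp {f : ℂ → ℂ} (hf : Nice f) (c : ℂ) : ∫ z, f z * exp (c * CT f z) = ∫ z, f z := by
  obtain ⟨B, h0, hB⟩ := hf.bd_CT
  have key : HasSum (fun n : ℕ => ∫ z, (c ^ n / n.factorial) * (f z * CT f z ^ n)) (∫ z, f z * exp (c * CT f z)) := by
    refine hasSum_integral_of_dominated_convergence (fun n z => ‖f z‖ * ((‖c‖ * B) ^ n / n.factorial)) ?_ ?_ ?_ ?_ ?_
    · intro n; exact ((hf.pow n).int.const_mul _).1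
    · intro n
      refine Filter.Eventually.of_forall fun z => ?_
      have := pow_le_pow_left₀ (norm_nonneg _) (hB z) n
      simp only [norm_mul, norm_div, norm_pow, mul_pow, norm_natCast]
      calc _ ≤ ‖c‖ ^ n / n.factorial * (‖f z‖ * B ^ n) := by gcongr
        _ = _ := by ring
    · refine Filter.Eventually.of_forall fun z => ?_
      exact (Real.summable_pow_div_factorial _).mul_left _
    · simp_rw [tsum_mul_left]
      exact hf.int.norm.mul_const _
    · refine Filter.Eventually.of_forall fun z => ?_
      have := (NormedSpace.expSeries_div_hasSum_exp (𝔸 := ℂ) (c * CT f z)).mul_left (f z)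
      rw [← Complex.exp_eq_exp_ℂ] at this
      have he : (fun n : ℕ => (c ^ n / n.factorial) * (f z * CT f z ^ n)) =
          fun n : ℕ => f z * ((c * CT f z) ^ n / n.factorial) := by
        ext n; simp only [mul_pow]; ring
      rw [he]
      exact this
  have k2 : HasSum (fun n : ℕ => ∫ z, (c ^ n / n.factorial) * (f z * CT f z ^ n)) (∫ z, f z) := by
    convert hasSum_single 0 ?_ using 1
    · simp
    · intro n hn
      obtain ⟨m, rfl⟩ := Nat.exists_eq_succ_of_ne_zero hn
      rw [integral_const_mul, CT_pow_int hf m, mul_zero]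
  exact key.unique k2

lemma exists_coord (θt η ξ : E3)
    (hθunit : ‖θt‖ = 1) (hηunit : ‖η‖ = 1) (hortho : ⟪θt, η⟫ = 0)
    (hξ : ξ ≠ 0) (hξθ : ⟪ξ, θt⟫ = 0) (hξη : ⟪ξ, η⟫ = 0) :
    ∃ e : (ℝ × ℂ) ≃ᵐ E3, MeasurePreserving e (volume.prod volume) volume ∧
      ∀ t z, e (t, z) = z.re • θt + z.im • η + t • (‖ξ‖⁻¹ • ξ) := by
  have hn : ‖ξ‖ ≠ 0 := norm_ne_zero_iff.2 hξ
  have hon : Orthonormal ℝ ![θt, η, ‖ξ‖⁻¹ • ξ] := by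
    have h1 : ⟪η, θt⟫ = 0 := by rw [real_inner_comm]; exact hortho
    have h2 : ⟪θt, ξ⟫ = 0 := by rw [real_inner_comm]; exact hξθ
    have h3 : ⟪η, ξ⟫ = 0 := by rw [real_inner_comm]; exact hξη
    constructor
    · intro i; fin_cases i <;> simp [hθunit, hηunit, norm_smul, hn]
    · intro i j hij
      fin_cases i <;> fin_cases j <;> simp [inner_smul_left, inner_smul_right, *] at hij ⊢
  have hsp : ⊤ ≤ Submodule.span ℝ (Set.range ![θt, η, ‖ξ‖⁻¹ • ξ]) := by
    rw [hon.linearIndependent.span_eq_top_of_card_eq_finrank' (by simp)]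
  let b := OrthonormalBasis.mk hon hsp
  let e1 : (Fin 3 → ℝ) ≃ᵐ ℝ × (Fin 2 → ℝ) := MeasurableEquiv.piFinSuccAbove (fun _ => ℝ) 2
  have h1 : MeasurePreserving e1 volume (volume.prod volume) := volume_preserving_piFinSuccAbove (fun _ => ℝ) 2
  have h2 := Complex.volume_preserving_equiv_pi
  let e2 : (ℝ × ℂ) ≃ᵐ ℝ × (Fin 2 → ℝ) := (MeasurableEquiv.refl ℝ).prodCongr Complex.measurableEquivPi
  have h3 : MeasurePreserving e2 (volume.prod volume) (volume.prod volume) :=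
    (MeasurePreserving.id (volume : Measure ℝ)).prod h2
  refine ⟨e2.trans (e1.symm.trans ((MeasurableEquiv.toLp 2 (Fin 3 → ℝ)).trans b.measurableEquiv.symm)), ?_, ?_⟩
  · exact b.measurePreserving_measurableEquiv.symm.comp ((PiLp.volume_preserving_toLp (Fin 3)).comp (h1.symm.comp h3))
  · intro t z
    change b.repr.symm (WithLp.toLp 2 (Fin.insertNth (2 : Fin 3) t ![z.re, z.im])) = _
    rw [← b.sum_repr_symm, Fin.sum_univ_three]
    simp only [b, OrthonormalBasis.coe_mk]
    have : (Fin.insertNth (2 : Fin 3) t ![z.re, z.im] : Fin 3 → ℝ) = ![z.re, z.im, t] := by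
      ext i; fin_cases i <;> rfl
    rw [this]
    simp

theorem cauchy_transform_integral_identity
    (R₁ M : ℝ) (hR₁ : 0 < R₁)
    (θt η ξ : E3)
    (hθunit : ‖θt‖ = 1) (hηunit : ‖η‖ = 1) (hortho : ⟪θt, η⟫ = 0)
    (hξ : ξ ≠ 0) (hξθ : ⟪ξ, θt⟫ = 0) (hξη : ⟪ξ, η⟫ = 0)
    (A : E3 → EuclideanSpace ℂ (Fin 3))
    (hAint : Integrable A) (hAbd : ∀ x, ‖A x‖ ≤ M)
    (hAsupp : ∀ x : E3, (⟪x, θt⟫ : ℝ) ^ 2 + (⟪x, η⟫ : ℝ) ^ 2 ≥ R₁ ^ 2 → A x = 0)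
    (Φ : E3 → ℂ)
    (hΦ : ∀ x, Φ x = (-I / (2 * Real.pi)) *
      ∫ s : ℝ × ℝ,
        (∑ j : Fin 3, ((θt j : ℂ) + I * (η j : ℂ)) * (A (x - s.1 • θt - s.2 • η) j)) /
          ((s.1 : ℂ) + I * (s.2 : ℂ))) :
    ∫ x : E3,
        (∑ j : Fin 3, (A x j) * ((θt j : ℂ) + I * (η j : ℂ))) *
          Complex.exp (Φ x) * Complex.exp (-(I * ((⟪x, ξ⟫ : ℝ) : ℂ))) =
      ∑ j : Fin 3, ((θt j : ℂ) + I * (η j : ℂ)) *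
        ∫ x : E3, (A x j) * Complex.exp (-(I * ((⟪x, ξ⟫ : ℝ) : ℂ))) := by
  obtain ⟨e, he, hee⟩ := exists_coord θt η ξ hθunit hηunit hortho hξ hξθ hξη
  have hn : ‖ξ‖ ≠ 0 := norm_ne_zero_iff.2 hξ
  set c : ℂ := -I / (2 * Real.pi) with hc
  let F : E3 → ℂ := fun x => ∑ j : Fin 3, (A x j) * ((θt j : ℂ) + I * (η j : ℂ))
  let P : E3 → ℂ := fun x => Complex.exp (-(I * ((⟪x, ξ⟫ : ℝ) : ℂ)))
  have hPm : Continuous P := by fun_prop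
  have hPn : ∀ x, ‖P x‖ ≤ 1 := by
    intro x
    have : -(I * ((⟪x, ξ⟫ : ℝ) : ℂ)) = ((-⟪x, ξ⟫ : ℝ) : ℂ) * I := by push_cast; ring
    simp only [P]
    rw [this, Complex.norm_exp_ofReal_mul_I]
  have hAj : ∀ j, Integrable (fun x => A x j) := fun j =>
    (EuclideanSpace.proj (𝕜 := ℂ) j).integrable_comp hAint
  have hFi : Integrable F := integrable_finsetSum _ fun j _ => (hAj j).mul_const _
  -- right-hand side
  have hR : ∑ j : Fin 3, ((θt j : ℂ) + I * (η j : ℂ)) * ∫ x : E3, (A x j) * P x = ∫ x, F x * P x := by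
    simp_rw [← integral_const_mul]
    rw [← integral_finsetSum]
    · congr 1; ext x; simp only [F, Finset.sum_mul]
      refine Finset.sum_congr rfl fun j _ => ?_
      ring
    · intro j _
      exact ((hAj j).mul_bdd hPm.aestronglyMeasurable (Filter.Eventually.of_forall hPn)).const_mul _
  change ∫ x : E3, F x * Complex.exp (Φ x) * P x = ∑ j : Fin 3, ((θt j : ℂ) + I * (η j : ℂ)) * ∫ x : E3, (A x j) * P x
  rw [hR]
  -- bound
  obtain ⟨K, hK0, hK⟩ : ∃ K : ℝ, 0 ≤ K ∧ ∀ x, ‖F x‖ ≤ K := by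
    have hM0 : 0 ≤ M := (norm_nonneg _).trans (hAbd 0)
    refine ⟨∑ j : Fin 3, M * ‖(θt j : ℂ) + I * (η j : ℂ)‖, by positivity, fun x => ?_⟩
    refine (norm_sum_le _ _).trans (Finset.sum_le_sum fun j _ => ?_)
    rw [norm_mul]
    gcongr
    exact (PiLp.norm_apply_le (A x) j).trans (hAbd x)
  let G : ℝ → ℂ → ℂ := fun t z => F (e (t, z))
  have hGi : Integrable (fun p : ℝ × ℂ => G p.1 p.2) (volume.prod volume) :=
    (he.integrable_comp_emb e.measurableEmbedding).2 hFi
  have hGsupp : ∀ t z, z ∉ Metric.ball (0:ℂ) R₁ → G t z = 0 := by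
    intro t z hz
    have hz' : R₁ ≤ ‖z‖ := by simpa using hz
    have : A (e (t, z)) = 0 := by
      apply hAsupp
      have h1 : ⟪η, θt⟫ = 0 := by rw [real_inner_comm]; exact hortho
      have a1 : (⟪e (t, z), θt⟫ : ℝ) = z.re := by
        rw [hee]; simp [inner_add_left, inner_smul_left, h1, hξθ, hθunit]
      have a2 : (⟪e (t, z), η⟫ : ℝ) = z.im := by
        rw [hee]; simp [inner_add_left, inner_smul_left, hortho, hξη, hηunit]
      rw [a1, a2]
      have : z.re ^ 2 + z.im ^ 2 = ‖z‖ ^ 2 := by rw [Complex.sq_norm, Complex.normSq_apply]; ring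
      rw [this]
      exact pow_le_pow_left₀ hR₁.le hz' 2
    simp [G, F, this]
  have hGe : ∀ t z, ‖G t z‖ₑ ≤ ENNReal.ofReal K := fun t z => by
    rw [← ofReal_norm]; exact ENNReal.ofReal_le_ofReal (hK _)
  obtain ⟨B, hB0, hB⟩ : ∃ B : ℝ, 0 ≤ B ∧ ∀ t z, ‖CT (G t) z‖ ≤ B := by
    let B : ENNReal := ENNReal.ofReal K * (∫⁻ u in Metric.ball (0:ℂ) 1, ‖u⁻¹‖ₑ) + ENNReal.ofReal K * volume (Metric.ball (0:ℂ) R₁)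
    have hBt : B ≠ ⊤ := ENNReal.add_ne_top.2 ⟨ENNReal.mul_ne_top ENNReal.ofReal_ne_top ct_c0.ne,
      ENNReal.mul_ne_top ENNReal.ofReal_ne_top measure_ball_lt_top.ne⟩
    refine ⟨B.toReal, ENNReal.toReal_nonneg, fun t z => ?_⟩
    have h1 : ∫⁻ w, ‖G t w‖ₑ ≤ ENNReal.ofReal K * volume (Metric.ball (0:ℂ) R₁) := by
      rw [← lintegral_indicator_const measurableSet_ball]
      refine lintegral_mono fun w => ?_
      by_cases hw : w ∈ Metric.ball (0:ℂ) R₁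
      · rw [Set.indicator_of_mem hw]; exact hGe t w
      · rw [hGsupp t w hw]; simp
    have h2 : ‖CT (G t) z‖ₑ ≤ B :=
      (enorm_integral_le_lintegral_enorm _).trans ((ct_kbound (G t) _ (hGe t) z).trans (add_le_add le_rfl h1))
    rw [← toReal_enorm]
    exact ENNReal.toReal_mono hBt h2
  have hΦe : ∀ t z, Φ (e (t, z)) = c * CT (G t) z := by
    intro t z
    rw [hΦ]
    congr 1
    have hs : CT (G t) z = ∫ w, G t (z - w) * w⁻¹ := by
      rw [← integral_sub_left_eq_self _ volume z]
      simp [CT]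
    rw [hs, ← Complex.volume_preserving_equiv_real_prod.integral_comp Complex.measurableEquivRealProd.measurableEmbedding]
    congr 1; ext w
    have e1 : e (t, z) - w.re • θt - w.im • η = e (t, z - w) := by
      rw [hee, hee, Complex.sub_re, Complex.sub_im, sub_smul, sub_smul]; abel
    simp only [Complex.measurableEquivRealProd_apply]
    rw [e1, div_eq_mul_inv]
    congr 1
    · simp only [G, F]
      refine Finset.sum_congr rfl fun j _ => mul_comm _ _
    · rw [mul_comm I, Complex.re_add_im]
  have hPe : ∀ t z, P (e (t, z)) = Complex.exp (-(I * ((‖ξ‖ * t : ℝ) : ℂ))) := by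
    intro t z
    have h2 : ⟪θt, ξ⟫ = 0 := by rw [real_inner_comm]; exact hξθ
    have h3 : ⟪η, ξ⟫ = 0 := by rw [real_inner_comm]; exact hξη
    have : (⟪e (t, z), ξ⟫ : ℝ) = ‖ξ‖ * t := by
      rw [hee]; simp [inner_add_left, inner_smul_left, h2, h3]
      field_simp
    simp only [P, this]
  have hCTm : AEStronglyMeasurable (fun p : ℝ × ℂ => CT (G p.1) p.2) (volume.prod volume) := by
    have hq : Measure.QuasiMeasurePreserving (fun q : (ℝ × ℂ) × ℂ => (q.1.1, q.2))
        (((volume : Measure ℝ).prod (volume : Measure ℂ)).prod (volume : Measure ℂ)) (volume.prod volume) :=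
      (Measure.measurePreserving_swap.quasiMeasurePreserving.comp
        (Measure.quasiMeasurePreserving_fst.comp
          (((measurePreserving_prodAssoc (volume : Measure ℂ) (volume : Measure ℝ)
            (volume : Measure ℂ)).symm).quasiMeasurePreserving.comp
            Measure.measurePreserving_swap.quasiMeasurePreserving)))
    have hm : AEStronglyMeasurable (fun q : (ℝ × ℂ) × ℂ => G q.1.1 q.2 * (q.1.2 - q.2)⁻¹)
        (((volume : Measure ℝ).prod (volume : Measure ℂ)).prod (volume : Measure ℂ)) :=
      (hGi.1.comp_quasiMeasurePreserving hq).mul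
        (by fun_prop : Measurable fun q : (ℝ × ℂ) × ℂ => (q.1.2 - q.2)⁻¹).aestronglyMeasurable
    exact hm.integral_prod_right'
  have hPem : Measurable (fun p : ℝ × ℂ => P (e p)) := hPm.measurable.comp e.measurable
  have hI0 : Integrable (fun p : ℝ × ℂ => G p.1 p.2 * P (e p)) (volume.prod volume) :=
    hGi.mul_bdd hPem.aestronglyMeasurable (Filter.Eventually.of_forall fun p => hPn _)
  have hI1 : Integrable (fun p : ℝ × ℂ => G p.1 p.2 * exp (c * CT (G p.1) p.2) * P (e p)) (volume.prod volume) := by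
    refine Integrable.mul_bdd (c := 1) ?_ hPem.aestronglyMeasurable (Filter.Eventually.of_forall fun p => hPn _)
    refine hGi.mul_bdd (c := Real.exp (‖c‖ * B)) 
      (Complex.continuous_exp.comp_aestronglyMeasurable (hCTm.const_mul c)) (Filter.Eventually.of_forall fun p => ?_)
    refine (Complex.norm_exp_le_exp_norm _).trans (Real.exp_le_exp.2 ?_)
    rw [norm_mul]
    gcongr
    exact hB _ _
  rw [← he.integral_comp e.measurableEmbedding, ← he.integral_comp e.measurableEmbedding]
  have hL : (fun p : ℝ × ℂ => F (e p) * exp (Φ (e p)) * P (e p)) =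
      fun p : ℝ × ℂ => G p.1 p.2 * exp (c * CT (G p.1) p.2) * P (e p) := by
    ext ⟨t, z⟩
    rw [hΦe]
  rw [hL, integral_prod _ hI1]
  change _ = ∫ p : ℝ × ℂ, G p.1 p.2 * P (e p) ∂(volume.prod volume)
  rw [integral_prod _ hI0]
  refine integral_congr_ae ?_
  filter_upwards [hGi.prod_right_ae] with t ht
  have hnice : Nice (G t) := ⟨ht, K, fun z => hK _⟩
  simp only [hPe]
  rw [integral_mul_const, integral_mul_const, CT_exp hnice]
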